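/- Let i, j ∈ {1, 2}. Let g : ℝ² → ℝ be measurable with ‖g‖_{L²_{uloc}} < ∞, let ρ : ℝ² → ℝ be smooth with ∫_{ℝ²} (1+‖y‖²)² |∂^α ρ(y)|² dy < ∞ for every multi-index α with |α| ≤ 2, and let φ ∈ C_c^∞(ℝ²; ℝ). Set ρ̌(x) := ρ(−x). Then the functions x ↦ φ(x) · I_1^{ij}(ρ∗g)(x) and t ↦ g(t) · I_1^{ij}(ρ̌∗φ)(t) are integrable on ℝ², and ∫_{ℝ²} φ(x) I_1^{ij}(ρ∗g)(x) dx = ∫_{ℝ²} g(t) I_1^{ij}(ρ̌∗φ)(t) dt. -/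

import Mathlib

open MeasureTheory

/-- The kernel `γ_{ij}(z) = δ_{ij}/‖z‖³ − 3 z_i z_j/‖z‖⁵` on `ℝ²`. -/
noncomputable def gam (i j : Fin 2) (z : EuclideanSpace ℝ (Fin 2)) : ℝ :=
  (if i = j then (1 : ℝ) else 0) / ‖z‖ ^ 3 - 3 * z i * z j / ‖z‖ ^ 5

/-- The singular integral operator `I_1^{ij}` with cutoff `K = 1`. -/
noncomputable def Iop (i j : Fin 2) (f : EuclideanSpace ℝ (Fin 2) → ℝ)
    (x : EuclideanSpace ℝ (Fin 2)) : ℝ :=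
  ∫ y, gam i j (x - y) *
    (f x - f y - (if ‖x - y‖ ≤ 1 then fderiv ℝ f x (x - y) else 0))

/-- The unit square `k + [0,1]²`. -/
def unitSquare (k : Fin 2 → ℤ) : Set (EuclideanSpace ℝ (Fin 2)) :=
  {x | ∀ i, (k i : ℝ) ≤ x i ∧ x i ≤ k i + 1}

open scoped ENNReal NNReal

/-- The half-open unit square `k + [0,1)²`. -/
def floorSquare (k : Fin 2 → ℤ) : Set (EuclideanSpace ℝ (Fin 2)) :=
  (fun x i => ⌊x i⌋) ⁻¹' {k}

lemma mem_floorSquare {k : Fin 2 → ℤ} {x : EuclideanSpace ℝ (Fin 2)} :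
    x ∈ floorSquare k ↔ ∀ i, ⌊x i⌋ = k i := by
  simp [floorSquare, funext_iff]

lemma measurableSet_floorSquare (k : Fin 2 → ℤ) : MeasurableSet (floorSquare k) := by
  apply measurableSet_preimage _ (measurableSet_singleton k)
  refine measurable_pi_lambda _ fun i => Int.measurable_floor.comp ?_
  fun_prop

lemma floorSquare_subset_unitSquare (k : Fin 2 → ℤ) : floorSquare k ⊆ unitSquare k := by
  intro x hx i
  have h := mem_floorSquare.1 hx i
  rw [Int.floor_eq_iff] at h
  exact ⟨h.1, h.2.le⟩

lemma volume_floorSquare (k : Fin 2 → ℤ) : volume (floorSquare k) = 1 := by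
  have h : floorSquare k = WithLp.ofLp ⁻¹'
      (Set.univ.pi fun i => Set.Ico (k i : ℝ) (k i + 1)) := by
    ext x
    simp [mem_floorSquare, Int.floor_eq_iff]
  rw [h, (PiLp.volume_preserving_ofLp (Fin 2)).measure_preimage
    (MeasurableSet.univ_pi fun i => measurableSet_Ico).nullMeasurableSet, Real.volume_pi_Ico]
  simp

lemma lintegral_eq_tsum_floorSquare (f : EuclideanSpace ℝ (Fin 2) → ℝ≥0∞) :
    ∫⁻ x, f x = ∑' k, ∫⁻ x in floorSquare k, f x := by
  rw [← lintegral_iUnion measurableSet_floorSquare (fun a b hab => ?_)]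
  · have h : ⋃ k, floorSquare k = Set.univ :=
      Set.iUnion_eq_univ_iff.2 fun x => ⟨fun i => ⌊x i⌋, mem_floorSquare.2 fun _ => rfl⟩
    rw [h, setLIntegral_univ]
  · exact Disjoint.preimage _ (by simpa using hab)

lemma norm_sub_le_of_mem_unitSquare {k : Fin 2 → ℤ} {s t : EuclideanSpace ℝ (Fin 2)}
    (hs : s ∈ unitSquare k) (ht : t ∈ unitSquare k) : ‖s - t‖ ≤ 2 := by
  rw [EuclideanSpace.norm_eq, Real.sqrt_le_left (by norm_num), Fin.sum_univ_two]
  have h (i : Fin 2) : ‖(s - t) i‖ ^ 2 ≤ 1 := by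
    have h1 := hs i
    have h2 := ht i
    rw [Real.norm_eq_abs, sq_abs, PiLp.sub_apply]
    nlinarith
  linarith [h 0, h 1]

lemma japanese_weight_le {E : Type*} [NormedAddCommGroup E] {s t : E} (h : ‖s - t‖ ≤ 2) :
    ((1 + ‖s‖ ^ 2) ^ 2)⁻¹ ≤ 81 * ((1 + ‖t‖ ^ 2) ^ 2)⁻¹ := by
  have h1 : 1 + ‖t‖ ^ 2 ≤ 9 * (1 + ‖s‖ ^ 2) := by
    have h2 : ‖t‖ ≤ ‖s‖ + 2 := by
      have := norm_sub_norm_le t s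
      rw [norm_sub_rev] at this
      linarith
    nlinarith [norm_nonneg t, norm_nonneg s, sq_nonneg (‖s‖ - 2)]
  rw [← div_eq_mul_inv, inv_eq_one_div, div_le_div_iff₀ (by positivity) (by positivity)]
  calc 1 * (1 + ‖t‖ ^ 2) ^ 2 ≤ 1 * (9 * (1 + ‖s‖ ^ 2)) ^ 2 := by gcongr
    _ = _ := by ring

/-- A uniformly locally integrable function is integrable against the weight
`(1 + ‖x - t‖²)⁻²`, uniformly in the centre `x`. -/
lemma lintegral_weight_mul_le {G : EuclideanSpace ℝ (Fin 2) → ℝ≥0∞} {M : ℝ≥0∞}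
    (hM : ∀ k, ∫⁻ x in unitSquare k, G x ≤ M) (x : EuclideanSpace ℝ (Fin 2)) :
    ∫⁻ t, ENNReal.ofReal ((1 + ‖x - t‖ ^ 2) ^ 2)⁻¹ * G t ≤
      81 * (∫⁻ t : EuclideanSpace ℝ (Fin 2), ENNReal.ofReal ((1 + ‖t‖ ^ 2) ^ 2)⁻¹) * M := by
  set W : EuclideanSpace ℝ (Fin 2) → ℝ≥0∞ := fun y => ENNReal.ofReal ((1 + ‖y‖ ^ 2) ^ 2)⁻¹
  have hW : Measurable W := by fun_prop
  have harnack (k : Fin 2 → ℤ) (t) (ht : t ∈ floorSquare k) :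
      W (x - t) ≤ 81 * ∫⁻ s in floorSquare k, W (x - s) := by
    calc W (x - t) = ∫⁻ _ in floorSquare k, W (x - t) := by
          rw [setLIntegral_const, volume_floorSquare, mul_one]
      _ ≤ ∫⁻ s in floorSquare k, 81 * W (x - s) := by
          refine setLIntegral_mono (by fun_prop) fun s hs => ?_
          have h := norm_sub_le_of_mem_unitSquare (floorSquare_subset_unitSquare k hs)
            (floorSquare_subset_unitSquare k ht)
          rw [show (81 : ℝ≥0∞) = ENNReal.ofReal 81 by simp, ← ENNReal.ofReal_mul (by norm_num)]
          refine ENNReal.ofReal_le_ofReal (japanese_weight_le ?_)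
          rwa [sub_sub_sub_cancel_left]
      _ = _ := lintegral_const_mul _ (by fun_prop)
  calc ∫⁻ t, W (x - t) * G t
      = ∑' k, ∫⁻ t in floorSquare k, W (x - t) * G t := lintegral_eq_tsum_floorSquare _
    _ ≤ ∑' k, 81 * (∫⁻ s in floorSquare k, W (x - s)) * M := by
        refine ENNReal.tsum_le_tsum fun k => ?_
        have hfin : 81 * ∫⁻ s in floorSquare k, W (x - s) ≠ ∞ := by
          refine ENNReal.mul_ne_top (by simp) (ne_top_of_le_ne_top (b := 1) (by simp) ?_)
          calc ∫⁻ s in floorSquare k, W (x - s) ≤ ∫⁻ s in floorSquare k, 1 := by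
                refine lintegral_mono fun s => ?_
                rw [ENNReal.ofReal_le_one]
                exact inv_le_one_of_one_le₀ (one_le_pow₀ (by nlinarith [sq_nonneg ‖x - s‖]))
            _ = 1 := by rw [setLIntegral_const, volume_floorSquare, mul_one]
        calc ∫⁻ t in floorSquare k, W (x - t) * G t
            ≤ ∫⁻ t in floorSquare k, (81 * ∫⁻ s in floorSquare k, W (x - s)) * G t :=
              setLIntegral_mono' (measurableSet_floorSquare k) fun t ht => by
                gcongr
                exact harnack k t ht
          _ = (81 * ∫⁻ s in floorSquare k, W (x - s)) * ∫⁻ t in floorSquare k, G t :=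
              lintegral_const_mul' _ _ hfin
          _ ≤ _ := by
              gcongr
              exact (lintegral_mono_set (floorSquare_subset_unitSquare k)).trans (hM k)
    _ = 81 * (∫⁻ s, W (x - s)) * M := by
        rw [ENNReal.tsum_mul_right, ENNReal.tsum_mul_left, ← lintegral_eq_tsum_floorSquare]
    _ = 81 * (∫⁻ s, W s) * M := by rw [lintegral_sub_left_eq_self W x]

lemma lintegral_japanese_weight_ne_top :
    ∫⁻ t : EuclideanSpace ℝ (Fin 2), ENNReal.ofReal ((1 + ‖t‖ ^ 2) ^ 2)⁻¹ ≠ ∞ := by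
  have h := integrable_rpow_neg_one_add_norm_sq (E := EuclideanSpace ℝ (Fin 2))
    (μ := volume) (r := 4) (by simp; norm_num)
  have h2 : Integrable fun t : EuclideanSpace ℝ (Fin 2) => ((1 + ‖t‖ ^ 2) ^ 2)⁻¹ := by
    refine h.congr (.of_forall fun t => ?_)
    simp only
    rw [show (-4 / 2 : ℝ) = -((2 : ℕ) : ℝ) by norm_num, Real.rpow_neg (by positivity),
      Real.rpow_natCast]
  exact h2.lintegral_lt_top.ne

/-- A weighted `L²` function and an `L²_uloc` function have a uniformly absolutely
convergent convolution. -/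
lemma exists_lintegral_conv_le {F : Type*} [NormedAddCommGroup F]
    {D : EuclideanSpace ℝ (Fin 2) → F} {g : EuclideanSpace ℝ (Fin 2) → ℝ}
    (hD : Integrable fun y => (1 + ‖y‖ ^ 2) ^ 2 * ‖D y‖ ^ 2)
    (hg : Measurable g)
    (hgu : ∃ M : ℝ, ∀ k : Fin 2 → ℤ,
      ∫⁻ x in unitSquare k, ENNReal.ofReal (g x ^ 2) ≤ ENNReal.ofReal M) :
    ∃ C : ℝ≥0, ∀ x, ∫⁻ t, ‖g t‖ₑ * ‖D (x - t)‖ₑ ≤ C := by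
  obtain ⟨M, hM⟩ := hgu
  have hfin : 81 * (∫⁻ t : EuclideanSpace ℝ (Fin 2), ENNReal.ofReal ((1 + ‖t‖ ^ 2) ^ 2)⁻¹) *
      ENNReal.ofReal M + ∫⁻ y, ENNReal.ofReal ((1 + ‖y‖ ^ 2) ^ 2 * ‖D y‖ ^ 2) ≠ ∞ :=
    ENNReal.add_ne_top.2 ⟨ENNReal.mul_ne_top
      (ENNReal.mul_ne_top (by simp) lintegral_japanese_weight_ne_top) (by simp),
      hD.lintegral_lt_top.ne⟩
  refine ⟨_, fun x => LE.le.trans_eq ?_ (ENNReal.coe_toNNReal hfin).symm⟩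
  have key (t) : ‖g t‖ₑ * ‖D (x - t)‖ₑ ≤
      ENNReal.ofReal ((1 + ‖x - t‖ ^ 2) ^ 2)⁻¹ * ENNReal.ofReal (g t ^ 2) +
        ENNReal.ofReal ((1 + ‖x - t‖ ^ 2) ^ 2 * ‖D (x - t)‖ ^ 2) := by
    rw [← ofReal_norm, ← ofReal_norm, ← ENNReal.ofReal_mul (by positivity),
      ← ENNReal.ofReal_mul (by positivity), ← ENNReal.ofReal_add (by positivity) (by positivity)]
    refine ENNReal.ofReal_le_ofReal ?_
    rw [← sq_abs (g t), ← Real.norm_eq_abs]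
    set a := 1 + ‖x - t‖ ^ 2
    have ha : 0 < a := by positivity
    have h1 : (a ^ 2)⁻¹ * ‖g t‖ ^ 2 = (a⁻¹ * ‖g t‖) ^ 2 := by rw [mul_pow, inv_pow]
    have h2 : a ^ 2 * ‖D (x - t)‖ ^ 2 = (a * ‖D (x - t)‖) ^ 2 := by ring
    have h3 : ‖g t‖ * ‖D (x - t)‖ = (a⁻¹ * ‖g t‖) * (a * ‖D (x - t)‖) := by
      field_simp
    rw [h1, h2, h3]
    nlinarith [sq_nonneg (a⁻¹ * ‖g t‖ - a * ‖D (x - t)‖), sq_nonneg (a⁻¹ * ‖g t‖),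
      sq_nonneg (a * ‖D (x - t)‖)]
  refine (lintegral_mono key).trans ?_
  rw [lintegral_add_left (by fun_prop)]
  refine add_le_add (lintegral_weight_mul_le hM x) (le_of_eq ?_)
  exact lintegral_sub_left_eq_self
    (fun y => ENNReal.ofReal ((1 + ‖y‖ ^ 2) ^ 2 * ‖D y‖ ^ 2)) x

/-- Second order Taylor estimate with integral remainder. -/
lemma enorm_taylor_two_le {E : Type*} [NormedAddCommGroup E] [NormedSpace ℝ E]
    {ρ : E → ℝ} (hρ : ContDiff ℝ 2 ρ) (u z : E) :
    ‖ρ u - ρ (u - z) - fderiv ℝ ρ u z‖ₑ ≤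
      ‖z‖ₑ ^ 2 * ∫⁻ s in Set.Ioc (0 : ℝ) 1, ‖fderiv ℝ (fderiv ℝ ρ) (u - s • z)‖ₑ := by
  have hρ1 : ContDiff ℝ 1 (fderiv ℝ ρ) := hρ.fderiv_right (by norm_num)
  have hρ2 : Continuous (fderiv ℝ (fderiv ℝ ρ)) := hρ1.continuous_fderiv (by norm_num)
  have hline (s : ℝ) : HasDerivAt (fun s : ℝ => u - s • z) (-z) s := by
    simpa using ((hasDerivAt_id s).smul_const z).const_sub u
  set c : ℝ := ∫ s in (0 : ℝ)..1, ‖fderiv ℝ (fderiv ℝ ρ) (u - s • z)‖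
  have hcD : Continuous fun s : ℝ => fderiv ℝ (fderiv ℝ ρ) (u - s • z) :=
    hρ2.comp (by fun_prop)
  have hcont : Continuous fun s : ℝ => ‖fderiv ℝ (fderiv ℝ ρ) (u - s • z)‖ :=
    (continuous_norm (E := E →L[ℝ] E →L[ℝ] ℝ)).comp hcD
  have hgrad (s : ℝ) (hs : s ∈ Set.Ico (0 : ℝ) 1) :
      ‖fderiv ℝ ρ (u - s • z) - fderiv ℝ ρ u‖ ≤ c * ‖z‖ := by
    have hd (r : ℝ) : HasDerivAt (fun s : ℝ => fderiv ℝ ρ (u - s • z))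
        (fderiv ℝ (fderiv ℝ ρ) (u - r • z) (-z)) r :=
      ((hρ1.differentiable (by norm_num)) (u - r • z)).hasFDerivAt.comp_hasDerivAt r (hline r)
    have hc2 : Continuous fun r : ℝ => fderiv ℝ (fderiv ℝ ρ) (u - r • z) (-z) :=
      hcD.clm_apply continuous_const
    have heq := intervalIntegral.integral_eq_sub_of_hasDerivAt (a := 0) (b := s)
      (fun r _ => hd r) (hc2.intervalIntegrable _ _)
    simp only [zero_smul, sub_zero] at heq
    rw [← heq]
    calc _ ≤ ∫ r in (0 : ℝ)..s, ‖fderiv ℝ (fderiv ℝ ρ) (u - r • z) (-z)‖ :=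
          intervalIntegral.norm_integral_le_integral_norm hs.1
      _ ≤ ∫ r in (0 : ℝ)..s, ‖fderiv ℝ (fderiv ℝ ρ) (u - r • z)‖ * ‖z‖ := by
          refine intervalIntegral.integral_mono_on hs.1 (hc2.norm.intervalIntegrable _ _)
            ((hcont.mul continuous_const).intervalIntegrable _ _) fun r _ => ?_
          simpa using (fderiv ℝ (fderiv ℝ ρ) (u - r • z)).le_opNorm (-z)
      _ = (∫ r in (0 : ℝ)..s, ‖fderiv ℝ (fderiv ℝ ρ) (u - r • z)‖) * ‖z‖ :=
          intervalIntegral.integral_mul_const _ _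
      _ ≤ c * ‖z‖ := by
          gcongr
          exact intervalIntegral.integral_mono_interval le_rfl hs.1 hs.2.le
            (.of_forall fun r => norm_nonneg (fderiv ℝ (fderiv ℝ ρ) (u - r • z)))
            (hcont.intervalIntegrable _ _)
  have hmain : ‖ρ u - ρ (u - z) - fderiv ℝ ρ u z‖ ≤ c * ‖z‖ * ‖z‖ := by
    have hd (s : ℝ) : HasDerivAt (fun s : ℝ => ρ (u - s • z) + s * fderiv ℝ ρ u z)
        (fderiv ℝ ρ (u - s • z) (-z) + fderiv ℝ ρ u z) s := by
      have h1 := ((hρ.differentiable (by norm_num)) (u - s • z)).hasFDerivAt.comp_hasDerivAt s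
        (hline s)
      simpa using h1.fun_add ((hasDerivAt_id s).mul_const (fderiv ℝ ρ u z))
    have h := norm_image_sub_le_of_norm_deriv_le_segment_01' (C := c * ‖z‖ * ‖z‖)
      (fun s _ => (hd s).hasDerivWithinAt) fun s hs => ?_
    · have heq : ρ (u - (1 : ℝ) • z) + 1 * fderiv ℝ ρ u z -
          (ρ (u - (0 : ℝ) • z) + 0 * fderiv ℝ ρ u z) = -(ρ u - ρ (u - z) - fderiv ℝ ρ u z) := by
        rw [one_smul, zero_smul, sub_zero]
        ring
      rw [heq, norm_neg] at h
      exact h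
    · have h2 := (fderiv ℝ ρ (u - s • z) - fderiv ℝ ρ u).le_of_opNorm_le (hgrad s hs) (-z)
      rw [norm_neg] at h2
      have heq : fderiv ℝ ρ (u - s • z) (-z) + fderiv ℝ ρ u z =
          (fderiv ℝ ρ (u - s • z) - fderiv ℝ ρ u) (-z) := by
        rw [sub_apply, map_neg (fderiv ℝ ρ u), sub_neg_eq_add]
      rw [heq]
      exact h2
  have hc : ∫⁻ s in Set.Ioc (0 : ℝ) 1, ‖fderiv ℝ (fderiv ℝ ρ) (u - s • z)‖ₑ
      = ENNReal.ofReal c := by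
    have hint := (Continuous.intervalIntegrable (E := E →L[ℝ] E →L[ℝ] ℝ) hcD 0 1 (μ := volume)).1
    rw [← ofReal_integral_norm_eq_lintegral_enorm hint,
      ← intervalIntegral.integral_of_le zero_le_one]
  rw [hc, ← ofReal_norm, ← ofReal_norm, ← ENNReal.ofReal_pow (norm_nonneg _),
    ← ENNReal.ofReal_mul (by positivity)]
  exact ENNReal.ofReal_le_ofReal (hmain.trans_eq (by ring))

/-- The Euclidean plane. -/
abbrev Plane := EuclideanSpace ℝ (Fin 2)

/-- `ρ` is `C²` and its convolutions, and those of its first two derivatives, with `|g|` are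
bounded by `C`. -/
structure ConvBounds (ρ g : Plane → ℝ) (C : ℝ≥0) : Prop where
  contDiff : ContDiff ℝ 2 ρ
  measurable : Measurable g
  bound : ∀ x, ∫⁻ t, ‖g t‖ₑ * ‖ρ (x - t)‖ₑ ≤ C
  bound_fderiv : ∀ x, ∫⁻ t, ‖g t‖ₑ * ‖fderiv ℝ ρ (x - t)‖ₑ ≤ C
  bound_fderiv_fderiv : ∀ x, ∫⁻ t, ‖g t‖ₑ * ‖fderiv ℝ (fderiv ℝ ρ) (x - t)‖ₑ ≤ C

lemma exists_convBounds {ρ g : Plane → ℝ} (hg : Measurable g)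
    (hgu : ∃ M : ℝ, ∀ k : Fin 2 → ℤ,
      ∫⁻ x in unitSquare k, ENNReal.ofReal (g x ^ 2) ≤ ENNReal.ofReal M)
    (hρ : ContDiff ℝ 2 ρ)
    (hρm : ∀ n : ℕ, n ≤ 2 →
      Integrable (fun y => (1 + ‖y‖ ^ 2) ^ 2 * ‖iteratedFDeriv ℝ n ρ y‖ ^ 2)) :
    ∃ C, ConvBounds ρ g C := by
  have h0 := hρm 0 (by norm_num)
  have h1 := hρm 1 (by norm_num)
  have h2 := hρm 2 le_rfl
  simp only [norm_iteratedFDeriv_zero] at h0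
  simp only [norm_iteratedFDeriv_one] at h1
  simp only [← norm_iteratedFDeriv_fderiv (n := 1), norm_iteratedFDeriv_one] at h2
  obtain ⟨C0, h0⟩ := exists_lintegral_conv_le h0 hg hgu
  obtain ⟨C1, h1⟩ := exists_lintegral_conv_le h1 hg hgu
  obtain ⟨C2, h2⟩ := exists_lintegral_conv_le h2 hg hgu
  refine ⟨C0 + C1 + C2, hρ, hg, fun x => (h0 x).trans ?_, fun x => (h1 x).trans ?_,
    fun x => (h2 x).trans ?_⟩ <;> norm_cast
  · rw [add_assoc]
    exact le_self_add
  · exact (le_add_self.trans le_self_add)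
  · exact le_add_self

/-- The first order Taylor remainder at `u` with increment `-z`, the linear term being cut off
at `‖z‖ ≤ 1`. -/
noncomputable def cutRemainder (ρ : Plane → ℝ) (u z : Plane) : ℝ :=
  ρ u - ρ (u - z) - if ‖z‖ ≤ 1 then fderiv ℝ ρ u z else 0

namespace ConvBounds

variable {ρ g : Plane → ℝ} {C : ℝ≥0}

lemma continuous (h : ConvBounds ρ g C) : Continuous ρ := h.contDiff.continuous

lemma continuous_fderiv (h : ConvBounds ρ g C) : Continuous (fderiv ℝ ρ) :=
  h.contDiff.continuous_fderiv (by norm_num)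

lemma continuous_fderiv_fderiv (h : ConvBounds ρ g C) : Continuous (fderiv ℝ (fderiv ℝ ρ)) :=
  (h.contDiff.fderiv_right (m := 1) (by norm_num)).continuous_fderiv (by norm_num)

lemma integrable (h : ConvBounds ρ g C) (x : Plane) :
    Integrable fun t => ρ (x - t) * g t := by
  have h1 := h.continuous
  have h2 := h.measurable
  refine ⟨by fun_prop, ?_⟩
  rw [HasFiniteIntegral]
  simp_rw [enorm_mul, mul_comm]
  exact (h.bound x).trans_lt ENNReal.coe_lt_top

lemma integrable_fderiv (h : ConvBounds ρ g C) (x : Plane) :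
    Integrable fun t => g t • fderiv ℝ ρ (x - t) := by
  have h1 := h.continuous_fderiv
  have h2 := h.measurable
  refine ⟨by fun_prop, ?_⟩
  rw [HasFiniteIntegral]
  simp_rw [enorm_smul]
  exact (h.bound_fderiv x).trans_lt ENNReal.coe_lt_top

lemma lintegral_taylor_le (h : ConvBounds ρ g C) (x z : Plane) :
    ∫⁻ t, ‖g t‖ₑ * ‖ρ (x - t) - ρ (x - t - z) - fderiv ℝ ρ (x - t) z‖ₑ ≤ ‖z‖ₑ ^ 2 * C := by
  have h1 := h.continuous_fderiv_fderiv
  have h2 := h.measurable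
  calc _ ≤ ∫⁻ t, ‖z‖ₑ ^ 2 * ∫⁻ s in Set.Ioc (0 : ℝ) 1,
        ‖g t‖ₑ * ‖fderiv ℝ (fderiv ℝ ρ) (x - t - s • z)‖ₑ := by
        refine lintegral_mono fun t => ?_
        rw [lintegral_const_mul _ (by fun_prop), mul_left_comm]
        gcongr
        exact enorm_taylor_two_le h.contDiff _ _
    _ = ‖z‖ₑ ^ 2 * ∫⁻ s in Set.Ioc (0 : ℝ) 1, ∫⁻ t,
        ‖g t‖ₑ * ‖fderiv ℝ (fderiv ℝ ρ) (x - s • z - t)‖ₑ := by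
        rw [lintegral_const_mul' _ _ (by simp), lintegral_lintegral_swap (by fun_prop)]
        simp only [sub_right_comm]
    _ ≤ ‖z‖ₑ ^ 2 * ∫⁻ s in Set.Ioc (0 : ℝ) 1, (C : ℝ≥0∞) := by
        gcongr with s
        exact h.bound_fderiv_fderiv _
    _ = ‖z‖ₑ ^ 2 * C := by simp

lemma hasFDerivAt (h : ConvBounds ρ g C) (x : Plane) :
    HasFDerivAt (fun z => ∫ t, ρ (z - t) * g t) (∫ t, g t • fderiv ℝ ρ (x - t)) x := by
  refine HasFDerivAt.of_isLittleO (Asymptotics.IsBigO.trans_isLittleO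
    (g := fun y => ‖y - x‖ ^ 2) ?_ ?_)
  · refine Asymptotics.IsBigO.of_bound C (.of_forall fun y => ?_)
    have hlin : (∫ t, g t • fderiv ℝ ρ (x - t)) (y - x) =
        ∫ t, g t * fderiv ℝ ρ (x - t) (y - x) := by
      rw [ContinuousLinearMap.integral_apply (h.integrable_fderiv x)]
      rfl
    have hlini : Integrable fun t => g t * fderiv ℝ ρ (x - t) (y - x) :=
      (h.integrable_fderiv x).apply_continuousLinearMap (y - x)
    rw [hlin, ← integral_sub (h.integrable y) (h.integrable x), ← integral_sub
      (f := fun t => ρ (y - t) * g t - ρ (x - t) * g t)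
      ((h.integrable y).sub (h.integrable x)) hlini]
    have hle : ‖∫ t, ρ (y - t) * g t - ρ (x - t) * g t - g t * fderiv ℝ ρ (x - t) (y - x)‖ₑ ≤
        ‖y - x‖ₑ ^ 2 * C := by
      refine (enorm_integral_le_lintegral_enorm _).trans ?_
      rw [← enorm_neg (y - x), neg_sub]
      refine (lintegral_mono fun t => ?_).trans (h.lintegral_taylor_le x (x - y))
      rw [← enorm_mul, ← enorm_neg]
      refine le_of_eq (congrArg _ ?_)
      rw [show x - t - (x - y) = y - t by abel, ← neg_sub x y, map_neg]
      ring
    rw [← ofReal_norm, ← ofReal_norm, ← ENNReal.ofReal_pow (norm_nonneg _),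
      ← ENNReal.ofReal_coe_nnreal, ← ENNReal.ofReal_mul (by positivity),
      ENNReal.ofReal_le_ofReal_iff (by positivity)] at hle
    rw [norm_pow, norm_norm, mul_comm]
    exact hle
  · exact (Asymptotics.isLittleO_norm_pow_id (E' := Plane) one_lt_two).comp_tendsto
      (tendsto_sub_nhds_zero_iff.2 (Filter.tendsto_id (x := nhds x)))

lemma measurable_cutRemainder (h : ConvBounds ρ g C) :
    Measurable fun p : Plane × Plane => cutRemainder ρ p.1 p.2 := by
  have h1 := h.continuous
  have h2 := h.continuous_fderiv
  unfold cutRemainder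
  refine Measurable.sub (by fun_prop) (Measurable.ite ?_ ?_ measurable_const)
  · exact measurableSet_le (by fun_prop) measurable_const
  · exact (h2.comp continuous_fst).clm_apply continuous_snd |>.measurable

lemma lintegral_cutRemainder_le (h : ConvBounds ρ g C) (x z : Plane) :
    ∫⁻ t, ‖g t‖ₑ * ‖cutRemainder ρ (x - t) z‖ₑ ≤
      ENNReal.ofReal (min (‖z‖ ^ 2) 1) * (2 * C) := by
  have h1 := h.continuous.measurable
  have h2 := h.measurable
  unfold cutRemainder
  by_cases hz : ‖z‖ ≤ 1
  · simp only [hz, if_true]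
    rw [min_eq_left (pow_le_one₀ (norm_nonneg z) hz), ENNReal.ofReal_pow (norm_nonneg z),
      ofReal_norm]
    refine (h.lintegral_taylor_le x z).trans ?_
    gcongr
    exact le_mul_of_one_le_left (by simp) (by norm_num)
  · simp only [hz, if_false, sub_zero]
    rw [min_eq_right (one_le_pow₀ (not_le.1 hz).le), ENNReal.ofReal_one, one_mul, two_mul]
    calc _ ≤ ∫⁻ t, ‖g t‖ₑ * ‖ρ (x - t)‖ₑ + ‖g t‖ₑ * ‖ρ (x - z - t)‖ₑ := by
          refine lintegral_mono fun t => ?_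
          rw [← mul_add, sub_right_comm x z t]
          gcongr
          exact enorm_sub_le
      _ ≤ C + C := by
          rw [lintegral_add_left (by fun_prop)]
          exact add_le_add (h.bound _) (h.bound _)

end ConvBounds

lemma measurable_gam (i j : Fin 2) : Measurable (gam i j) := by
  unfold gam
  fun_prop

lemma gam_neg (i j : Fin 2) (z : Plane) : gam i j (-z) = gam i j z := by
  simp [gam]

lemma abs_gam_le (i j : Fin 2) (z : Plane) : |gam i j z| ≤ 4 * (‖z‖ ^ 3)⁻¹ := by
  rcases eq_or_ne z 0 with rfl | hz
  · simp [gam]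
  have hpos : 0 < ‖z‖ := norm_pos_iff.2 hz
  have h1 : |(if i = j then (1 : ℝ) else 0) / ‖z‖ ^ 3| ≤ (‖z‖ ^ 3)⁻¹ := by
    split_ifs
    · rw [abs_of_nonneg (by positivity), one_div]
    · simp
  have h2 : |3 * z i * z j / ‖z‖ ^ 5| ≤ 3 * (‖z‖ ^ 3)⁻¹ := by
    have hi := PiLp.norm_apply_le z i
    have hj := PiLp.norm_apply_le z j
    rw [Real.norm_eq_abs] at hi hj
    rw [abs_div, abs_mul, abs_mul, abs_of_pos (by positivity : 0 < ‖z‖ ^ 5),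
      div_le_iff₀ (by positivity), abs_of_pos (by norm_num : (0 : ℝ) < 3)]
    calc 3 * |z i| * |z j| ≤ 3 * ‖z‖ * ‖z‖ := by gcongr
      _ = 3 * (‖z‖ ^ 3)⁻¹ * ‖z‖ ^ 5 := by field_simp
  calc |gam i j z| ≤ _ := abs_sub _ _
    _ ≤ _ := by linarith

lemma integrable_norm_pow_three_inv_mul_min :
    Integrable fun z : Plane => (‖z‖ ^ 3)⁻¹ * min (‖z‖ ^ 2) 1 := by
  rw [integrable_fun_norm_addHaar volume (f := fun r => (r ^ 3)⁻¹ * min (r ^ 2) 1)]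
  refine (integrable_inv_one_add_sq.const_mul 2).integrableOn.mono'
    (by fun_prop) ?_
  refine (ae_restrict_iff' measurableSet_Ioi).2 (.of_forall fun r (hr : 0 < r) => ?_)
  have hmin : 0 ≤ min (r ^ 2) 1 := by positivity
  rw [finrank_euclideanSpace_fin, smul_eq_mul, Real.norm_of_nonneg (by positivity)]
  have h : r ^ (2 - 1) * ((r ^ 3)⁻¹ * min (r ^ 2) 1) = min (r ^ 2) 1 / r ^ 2 := by
    norm_num
    field_simp
  rw [h, ← div_eq_mul_inv, div_le_div_iff₀ (by positivity) (by positivity)]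
  rcases le_total (r ^ 2) 1 with h1 | h1
  · rw [min_eq_left h1]
    nlinarith [sq_nonneg r]
  · rw [min_eq_right h1]
    linarith

lemma lintegral_gam_mul_min_lt_top (i j : Fin 2) :
    ∫⁻ z, ‖gam i j z‖ₑ * ENNReal.ofReal (min (‖z‖ ^ 2) 1) < ∞ := by
  refine lt_of_le_of_lt (lintegral_mono fun z => ?_)
    (integrable_norm_pow_three_inv_mul_min.const_mul 4).lintegral_lt_top
  rw [← ofReal_norm, ← ENNReal.ofReal_mul (norm_nonneg _), ← mul_assoc, Real.norm_eq_abs]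
  refine ENNReal.ofReal_le_ofReal ?_
  gcongr
  exact abs_gam_le i j z

/-- The operator `I_1^{ij}` evaluated on a differentiable function, written in terms of the
increment variable. -/
noncomputable def remainderIntegral (i j : Fin 2) (ρ : Plane → ℝ) (u : Plane) : ℝ :=
  ∫ z, gam i j z * cutRemainder ρ u z

namespace ConvBounds

variable {ρ g : Plane → ℝ} {C : ℝ≥0}

lemma lintegral_gam_mul_cutRemainder_le (h : ConvBounds ρ g C) (i j : Fin 2) (x : Plane) :
    ∫⁻ z, ∫⁻ t, ‖g t * (gam i j z * cutRemainder ρ (x - t) z)‖ₑ ≤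
      (∫⁻ z, ‖gam i j z‖ₑ * ENNReal.ofReal (min (‖z‖ ^ 2) 1)) * (2 * C) := by
  rw [← lintegral_mul_const' _ _ (ENNReal.mul_ne_top (by simp) (by simp))]
  refine lintegral_mono fun z => ?_
  simp_rw [enorm_mul, mul_left_comm ‖g _‖ₑ]
  rw [lintegral_const_mul' _ _ (by simp), mul_assoc]
  gcongr
  exact h.lintegral_cutRemainder_le x z

lemma integrable_gam_mul_cutRemainder (h : ConvBounds ρ g C) (i j : Fin 2) (x : Plane) :
    Integrable (Function.uncurry fun z t => g t * (gam i j z * cutRemainder ρ (x - t) z))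
      (volume.prod volume) := by
  have h1 := h.measurable
  have h2 := measurable_gam i j
  have h3 := h.measurable_cutRemainder
  have hm : Measurable
      (Function.uncurry fun z t => g t * (gam i j z * cutRemainder ρ (x - t) z)) :=
    (h1.comp measurable_snd).mul ((h2.comp measurable_fst).mul
      (h3.comp ((measurable_const.sub measurable_snd).prodMk measurable_fst)))
  refine ⟨hm.aestronglyMeasurable, ?_⟩
  rw [HasFiniteIntegral, lintegral_prod _ hm.enorm.aemeasurable]
  exact (h.lintegral_gam_mul_cutRemainder_le i j x).trans_lt
    (ENNReal.mul_lt_top (lintegral_gam_mul_min_lt_top i j) (ENNReal.mul_lt_top (by simp) (by simp)))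

lemma integral_cutRemainder (h : ConvBounds ρ g C) (x z : Plane) :
    ∫ t, g t * cutRemainder ρ (x - t) z =
      cutRemainder (fun z => ∫ t, ρ (z - t) * g t) x z := by
  unfold cutRemainder
  rw [(h.hasFDerivAt x).fderiv, ContinuousLinearMap.integral_apply (h.integrable_fderiv x),
    ← integral_sub (h.integrable x) (h.integrable (x - z))]
  have hlin : Integrable fun t => g t * fderiv ℝ ρ (x - t) z :=
    (h.integrable_fderiv x).apply_continuousLinearMap z
  split_ifs with hz
  · refine Eq.trans ?_ (integral_sub (f := fun t => ρ (x - t) * g t - ρ (x - z - t) * g t)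
      ((h.integrable x).sub (h.integrable (x - z))) hlin)
    refine integral_congr_ae (.of_forall fun t => ?_)
    simp only [sub_right_comm x z t, smul_apply, smul_eq_mul]
    ring
  · rw [sub_zero]
    refine integral_congr_ae (.of_forall fun t => ?_)
    simp only [sub_right_comm x z t]
    ring

/-- `I_1^{ij}` commutes with convolution. -/
lemma Iop_conv (h : ConvBounds ρ g C) (i j : Fin 2) (x : Plane) :
    Iop i j (fun z => ∫ t, ρ (z - t) * g t) x =
      ∫ t, g t * remainderIntegral i j ρ (x - t) := by
  calc Iop i j (fun z => ∫ t, ρ (z - t) * g t) x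
      = ∫ z, gam i j z * cutRemainder (fun z => ∫ t, ρ (z - t) * g t) x z := by
        rw [← integral_sub_left_eq_self _ _ x]
        simp only [Iop, cutRemainder, sub_sub_cancel]
    _ = ∫ z, ∫ t, g t * (gam i j z * cutRemainder ρ (x - t) z) := by
        simp_rw [← h.integral_cutRemainder, mul_left_comm (g _), integral_const_mul]
    _ = ∫ t, g t * remainderIntegral i j ρ (x - t) := by
        rw [integral_integral_swap (h.integrable_gam_mul_cutRemainder i j x)]
        simp_rw [integral_const_mul, remainderIntegral]

lemma integrable_prod_remainderIntegral (h : ConvBounds ρ g C) (i j : Fin 2) {φ : Plane → ℝ}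
    (hφm : Measurable φ) (hφ : Integrable φ) :
    Integrable (Function.uncurry fun x t => φ x * (g t * remainderIntegral i j ρ (x - t)))
      (volume.prod volume) := by
  have h1 := h.measurable
  have h2 := measurable_gam i j
  have h3 := h.measurable_cutRemainder
  let F : (Plane × Plane) × Plane → ℝ := fun p =>
    φ p.1.1 * (g p.1.2 * (gam i j p.2 * cutRemainder ρ (p.1.1 - p.1.2) p.2))
  have hm : Measurable F := by
    have h4 : Measurable fun p : (Plane × Plane) × Plane => cutRemainder ρ (p.1.1 - p.1.2) p.2 :=
      h3.comp (((measurable_fst.comp measurable_fst).sub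
        (measurable_snd.comp measurable_fst)).prodMk measurable_snd)
    fun_prop
  have hF : Integrable F ((volume.prod volume).prod volume) := by
    refine ⟨hm.aestronglyMeasurable, ?_⟩
    rw [HasFiniteIntegral, lintegral_prod _ hm.enorm.aemeasurable,
      lintegral_prod _ hm.enorm.lintegral_prod_right'.aemeasurable]
    calc ∫⁻ x, ∫⁻ t, ∫⁻ z, ‖F ((x, t), z)‖ₑ
        = ∫⁻ x, ‖φ x‖ₑ * ∫⁻ z, ∫⁻ t, ‖g t * (gam i j z * cutRemainder ρ (x - t) z)‖ₑ := by
          refine lintegral_congr fun x => ?_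
          rw [lintegral_lintegral_swap
            (hm.comp (by fun_prop : Measurable fun q : Plane × Plane =>
              ((x, q.1), q.2))).enorm.aemeasurable]
          rw [← lintegral_const_mul' _ _ (by simp)]
          refine lintegral_congr fun z => ?_
          rw [← lintegral_const_mul' _ _ (by simp)]
          simp only [F, enorm_mul]
      _ ≤ ∫⁻ x, ‖φ x‖ₑ *
          ((∫⁻ z, ‖gam i j z‖ₑ * ENNReal.ofReal (min (‖z‖ ^ 2) 1)) * (2 * C)) := by
          gcongr with x
          exact h.lintegral_gam_mul_cutRemainder_le i j x
      _ < ∞ := by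
          rw [lintegral_mul_const _ hφm.enorm]
          exact ENNReal.mul_lt_top hφ.2 (ENNReal.mul_lt_top (lintegral_gam_mul_min_lt_top i j)
            (ENNReal.mul_lt_top (by simp) (by simp)))
  refine hF.integral_prod_left.congr (.of_forall fun p => ?_)
  simp only [F, integral_const_mul, remainderIntegral, Function.uncurry]

end ConvBounds

lemma fderiv_comp_neg_apply (ρ : Plane → ℝ) (u z : Plane) :
    fderiv ℝ (fun x => ρ (-x)) u z = -fderiv ℝ ρ (-u) z := by
  have h := (LinearIsometryEquiv.neg ℝ (E := Plane)).toContinuousLinearEquiv.comp_right_fderiv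
    (f := ρ) (x := u)
  have h2 := congrArg (fun L => L z) h
  simpa [Function.comp_def] using h2

lemma remainderIntegral_comp_neg (i j : Fin 2) (ρ : Plane → ℝ) (u : Plane) :
    remainderIntegral i j (fun x => ρ (-x)) u = remainderIntegral i j ρ (-u) := by
  unfold remainderIntegral
  rw [← integral_neg_eq_self]
  refine integral_congr_ae (.of_forall fun z => ?_)
  simp only [gam_neg, cutRemainder, fderiv_comp_neg_apply, norm_neg, map_neg, neg_neg]
  rw [show -(u - -z) = -u - z by abel]

/-- Duality formula: `∫ φ · I_1[ρ∗g] = ∫ g · I_1[ρ̌∗φ]` for `g ∈ L²_uloc`,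
`ρ` smooth with moments, and `φ ∈ C_c^∞`. -/
theorem stmt9 (i j : Fin 2) (g ρ φ : EuclideanSpace ℝ (Fin 2) → ℝ)
    (hg : Measurable g)
    (hgu : ∃ M : ℝ, ∀ k : Fin 2 → ℤ,
      ∫⁻ x in unitSquare k, ENNReal.ofReal (g x ^ 2) ≤ ENNReal.ofReal M)
    (hρ : ContDiff ℝ (⊤ : ℕ∞) ρ)
    (hρm : ∀ n : ℕ, n ≤ 2 →
      Integrable (fun y => (1 + ‖y‖ ^ 2) ^ 2 * ‖iteratedFDeriv ℝ n ρ y‖ ^ 2))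
    (hφ : ContDiff ℝ (⊤ : ℕ∞) φ) (hφc : HasCompactSupport φ) :
    Integrable (fun x => φ x * Iop i j (fun z => ∫ y, ρ (z - y) * g y) x) ∧
    Integrable (fun t => g t * Iop i j (fun z => ∫ y, ρ (-(z - y)) * φ y) t) ∧
    ∫ x, φ x * Iop i j (fun z => ∫ y, ρ (z - y) * g y) x
      = ∫ t, g t * Iop i j (fun z => ∫ y, ρ (-(z - y)) * φ y) t := by
  have hρ2 : ContDiff ℝ 2 ρ := contDiff_infty.1 hρ 2
  obtain ⟨C, hC⟩ := exists_convBounds hg hgu hρ2 hρm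
  have hφi : Integrable φ := hφ.continuous.integrable_of_hasCompactSupport hφc
  have hφ2 : Integrable fun x => φ x ^ 2 := by
    simp only [sq]
    exact (hφ.continuous.mul hφ.continuous).integrable_of_hasCompactSupport
      (HasCompactSupport.mul_right hφc)
  have hφu : ∃ M : ℝ, ∀ k : Fin 2 → ℤ,
      ∫⁻ x in unitSquare k, ENNReal.ofReal (φ x ^ 2) ≤ ENNReal.ofReal M := by
    refine ⟨∫ x, φ x ^ 2, fun k => ?_⟩
    rw [ofReal_integral_eq_lintegral_ofReal hφ2 (.of_forall fun x => sq_nonneg (φ x))]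
    exact setLIntegral_le_lintegral _ _
  obtain ⟨C', hC'⟩ := exists_convBounds (ρ := fun x => ρ (-x)) hφ.continuous.measurable hφu
    (hρ2.comp contDiff_neg) fun n hn => by
      refine (hρm n hn).comp_neg.congr (.of_forall fun y => ?_)
      have h := (LinearIsometryEquiv.neg ℝ (E := Plane)).norm_iteratedFDeriv_comp_right
        (𝕜 := ℝ) ρ y n
      simp only [Function.comp_def, LinearIsometryEquiv.coe_neg] at h
      simp only [h, norm_neg]
  have hint := hC.integrable_prod_remainderIntegral i j hφ.continuous.measurable hφi
  have hl (x : Plane) : φ x * Iop i j (fun z => ∫ y, ρ (z - y) * g y) x =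
      ∫ t, φ x * (g t * remainderIntegral i j ρ (x - t)) := by
    rw [hC.Iop_conv, integral_const_mul]
  have hr (t : Plane) : g t * Iop i j (fun z => ∫ y, ρ (-(z - y)) * φ y) t =
      ∫ x, φ x * (g t * remainderIntegral i j ρ (x - t)) := by
    rw [hC'.Iop_conv, ← integral_const_mul]
    refine integral_congr_ae (.of_forall fun x => ?_)
    simp only [remainderIntegral_comp_neg, neg_sub]
    ring
  simp only [hl, hr]
  exact ⟨hint.integral_prod_left, hint.integral_prod_right, integral_integral_swap hint⟩
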